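/- arXiv:1704.08934 — 3 statements merged into one kernel-verified Lean document; each statement's English description precedes it below -/
import Mathlib

section
/- Let n ≥ 3 and let φ be a 2-CNF encoding of AMO_n of minimum size. Then φ has no unit implicates, φ is a prime p-encoding, and |φ| = S₂(n). -/
/-- A literal is a variable together with a polarity (`true` = positive). -/
abbrev Lit (V : Type) := V × Bool

/-- The negation of a literal. -/
def negLit {V : Type} (l : Lit V) : Lit V := (l.1, !l.2)

/-- A clause is a finite set of literals. -/
abbrev Clause (V : Type) := Finset (Lit V)

/-- A CNF formula is a finite set of clauses. -/
abbrev CNF (V : Type) := Finset (Clause V)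

/-- A clause proper contains no complementary pair of literals. -/
def IsClause {V : Type} [DecidableEq V] (C : Clause V) : Prop := ∀ l ∈ C, negLit l ∉ C

instance {V : Type} [DecidableEq V] (C : Clause V) : Decidable (IsClause C) := by
  unfold IsClause; infer_instance

/-- A CNF formula proper consists of proper clauses. -/
def IsCNF {V : Type} [DecidableEq V] (φ : CNF V) : Prop := ∀ C ∈ φ, IsClause C

/-- Satisfaction of a literal by an assignment. -/
def LitSat {V : Type} (α : V → Bool) (l : Lit V) : Prop := α l.1 = l.2

/-- Satisfaction of a clause by an assignment. -/
def ClauseSat {V : Type} (α : V → Bool) (C : Clause V) : Prop := ∃ l ∈ C, LitSat α l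

/-- Satisfaction of a CNF formula by an assignment. -/
def CnfSat {V : Type} (α : V → Bool) (φ : CNF V) : Prop := ∀ C ∈ φ, ClauseSat α C

/-- `UnitDerives φ C` : the clause `C` can be derived from `φ` by a series of unit
resolutions (each step resolves a derived unit clause with another derived clause). -/
inductive UnitDerives {V : Type} [DecidableEq V] (φ : CNF V) : Clause V → Prop
  | base {C : Clause V} (h : C ∈ φ) : UnitDerives φ C
  | step {l : Lit V} {C : Clause V} (h1 : UnitDerives φ {l})
      (h2 : UnitDerives φ C) (h3 : negLit l ∈ C) :
      UnitDerives φ (C.erase (negLit l))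

/-- The formula `φ ∧ l` (adding a unit clause). -/
def addUnit {V : Type} [DecidableEq V] (φ : CNF V) (l : Lit V) : CNF V :=
  insert {l} φ

/-- The formula `φ ∧ g₁ ∧ … ∧ g_p` (adding finitely many unit clauses). -/
def addUnits {V : Type} [DecidableEq V] (φ : CNF V) (L : Finset (Lit V)) : CNF V :=
  φ ∪ L.image (fun l => ({l} : Clause V))

/-- Variables: `n` input variables and `ℓ` auxiliary variables. -/
abbrev Var (n ℓ : ℕ) : Type := Sum (Fin n) (Fin ℓ)

/-- The literal on the `i`-th input variable with polarity `b`. -/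
def inLit {n ℓ : ℕ} (i : Fin n) (b : Bool) : Lit (Var n ℓ) := (Sum.inl i, b)

/-- A p-encoding: (P1) `φ ∧ x_i` is satisfiable for each input variable `x_i`, and
(P2) `φ ∧ x_i ⊢₁ ¬x_j` for all `i ≠ j`. -/
def IsPEncoding {n ℓ : ℕ} (φ : CNF (Var n ℓ)) : Prop :=
  IsCNF φ ∧
  (∀ i : Fin n, ∃ α : Var n ℓ → Bool, CnfSat α φ ∧ α (Sum.inl i) = true) ∧
  (∀ i j : Fin n, i ≠ j →
    UnitDerives (addUnit φ (inLit i true)) {inLit j false})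

/-- A p-encoding relative to a set `I` of input indices. -/
def IsPEncodingOn {n ℓ : ℕ} (φ : CNF (Var n ℓ)) (I : Finset (Fin n)) : Prop :=
  IsCNF φ ∧
  (∀ i ∈ I, ∃ α : Var n ℓ → Bool, CnfSat α φ ∧ α (Sum.inl i) = true) ∧
  (∀ i ∈ I, ∀ j ∈ I, i ≠ j →
    UnitDerives (addUnit φ (inLit i true)) {inLit j false})

/-- 2-CNF: every clause has at most two literals. -/
def Is2CNF {V : Type} (φ : CNF V) : Prop := ∀ C ∈ φ, C.card ≤ 2

/-- The set of possible sizes of p-encodings with `n` input variables. -/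
def pencSizes (n : ℕ) : Set ℕ :=
  {k | ∃ ℓ : ℕ, ∃ φ : CNF (Var n ℓ), IsPEncoding φ ∧ φ.card = k}

/-- `S n` : the minimum size of a p-encoding with `n` input variables. -/
noncomputable def S (n : ℕ) : ℕ := sInf (pencSizes n)

/-- The set of possible sizes of 2-CNF p-encodings with `n` input variables. -/
def penc2Sizes (n : ℕ) : Set ℕ :=
  {k | ∃ ℓ : ℕ, ∃ φ : CNF (Var n ℓ), IsPEncoding φ ∧ Is2CNF φ ∧ φ.card = k}

/-- `S₂ n` : the minimum size of a 2-CNF p-encoding with `n` input variables. -/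
noncomputable def S2 (n : ℕ) : ℕ := sInf (penc2Sizes n)

/-- `φ(x,y)` is an encoding of the boolean function `f(x)`. -/
def Encodes {n ℓ : ℕ} (φ : CNF (Var n ℓ)) (f : (Fin n → Bool) → Prop) : Prop :=
  IsCNF φ ∧
  ∀ α : Fin n → Bool, f α ↔ ∃ β : Fin ℓ → Bool, CnfSat (Sum.elim α β) φ

/-- Injection of literals on input variables into literals of the encoding. -/
def inLits {n ℓ : ℕ} (G : Finset (Lit (Fin n))) : Finset (Lit (Var n ℓ)) :=
  G.image (fun g => ((Sum.inl g.1 : Var n ℓ), g.2))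

/-- Propagation complete encoding of `f`: an encoding such that whenever
`f ∧ g₁ ∧ … ∧ g_p ⊨ h` for literals on input variables (`p ≥ 1`), unit propagation
from `φ ∧ g₁ ∧ … ∧ g_p` derives `h` or derives the empty clause. -/
def IsPCEncoding {n ℓ : ℕ} (φ : CNF (Var n ℓ)) (f : (Fin n → Bool) → Prop) : Prop :=
  Encodes φ f ∧
  ∀ G : Finset (Lit (Fin n)), G.Nonempty → ∀ h : Lit (Fin n),
    (∀ α : Fin n → Bool, f α → (∀ g ∈ G, α g.1 = g.2) → α h.1 = h.2) →
    (UnitDerives (addUnits φ (inLits G)) {((Sum.inl h.1 : Var n ℓ), h.2)} ∨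
     UnitDerives (addUnits φ (inLits G)) (∅ : Clause (Var n ℓ)))

/-- The "at most one" function. -/
def AMO (n : ℕ) (α : Fin n → Bool) : Prop :=
  (Finset.univ.filter fun i => α i = true).card ≤ 1

/-- The "exactly one" function. -/
def EXO (n : ℕ) (α : Fin n → Bool) : Prop :=
  (Finset.univ.filter fun i => α i = true).card = 1

/-- `Qset φ i` : the set of clauses of `φ` containing the literal `¬x_i`. -/
def Qset {n ℓ : ℕ} (φ : CNF (Var n ℓ)) (i : Fin n) : CNF (Var n ℓ) :=
  φ.filter (fun C => inLit i false ∈ C)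

/-- Regular form: for each `i`, `|Q_i| = 2`, clauses of `Q_i` contain no input variables
other than `x_i`, and all clauses of `Q_i` are binary. -/
def RegularForm {n ℓ : ℕ} (φ : CNF (Var n ℓ)) : Prop :=
  ∀ i : Fin n,
    (Qset φ i).card = 2 ∧
    (∀ C ∈ Qset φ i, ∀ j : Fin n, ∀ b : Bool, ((Sum.inl j : Var n ℓ), b) ∈ C → j = i) ∧
    (∀ C ∈ Qset φ i, C.card = 2)

/-- `C` is an implicate of `φ`. -/
def Implicate {V : Type} (φ : CNF V) (C : Clause V) : Prop :=
  ∀ α : V → Bool, CnfSat α φ → ClauseSat α C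

/-- `C` is a prime implicate of `φ`. -/
def PrimeImplicate {V : Type} (φ : CNF V) (C : Clause V) : Prop :=
  Implicate φ C ∧ ∀ C' : Clause V, C' ⊂ C → ¬ Implicate φ C'

/-- `φ` is prime: every clause of `φ` is a prime implicate of `φ`. -/
def IsPrime {V : Type} (φ : CNF V) : Prop := ∀ C ∈ φ, PrimeImplicate φ C

/-- The set of clauses of `φ` in which the auxiliary variable `y` occurs
(as a positive or negative literal). -/
def occursIn {n ℓ : ℕ} (φ : CNF (Var n ℓ)) (y : Fin ℓ) : CNF (Var n ℓ) :=
  φ.filter (fun C => ((Sum.inr y : Var n ℓ), true) ∈ C ∨ ((Sum.inr y : Var n ℓ), false) ∈ C)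

/-- The substitution `g₁ ← g₂` on a literal: `g₁ ↦ g₂`, `¬g₁ ↦ ¬g₂`,
all other literals unchanged. -/
def substLit {V : Type} [DecidableEq V] (g₁ g₂ : Lit V) (l : Lit V) : Lit V :=
  if l.1 = g₁.1 then (if l.2 = g₁.2 then g₂ else negLit g₂) else l

/-- The substitution `g₁ ← g₂` applied to a clause. -/
def substClause {V : Type} [DecidableEq V] (g₁ g₂ : Lit V) (C : Clause V) : Clause V :=
  C.image (substLit g₁ g₂)

/-- The formula `φ[g₁ ← g₂]`: apply the substitution to every clause and remove the
clauses that became tautological (i.e. contain a complementary pair of literals). -/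
def substCNF {V : Type} [DecidableEq V] (g₁ g₂ : Lit V) (φ : CNF V) : CNF V :=
  (φ.image (substClause g₁ g₂)).filter (fun C => IsClause C)

/-- `restrict φ ρ` : the formula `φ(ρ)` obtained from `φ` by the partial assignment
given by the set of literals `ρ` (clauses satisfied by `ρ` are removed, and falsified
literals are removed from the remaining clauses). -/
def restrict {V : Type} [DecidableEq V] (φ : CNF V) (ρ : Finset (Lit V)) : CNF V :=
  (φ.filter (fun C => ∀ l ∈ ρ, l ∉ C)).image (fun C => C.filter (fun l => negLit l ∉ ρ))

section CnfSemantics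

variable {V : Type}

theorem negLit_negLit (l : Lit V) : negLit (negLit l) = l := by
  simp [negLit]

theorem litSat_negLit (α : V → Bool) (l : Lit V) : LitSat α (negLit l) ↔ ¬ LitSat α l := by
  rcases l with ⟨v, b⟩
  cases b <;> simp [LitSat, negLit]

theorem clauseSat_singleton (α : V → Bool) (l : Lit V) :
    ClauseSat α {l} ↔ LitSat α l := by
  simp [ClauseSat]

variable [DecidableEq V]

theorem UnitDerives.clauseSat {φ : CNF V} {C : Clause V} (h : UnitDerives φ C)
    {α : V → Bool} (hα : CnfSat α φ) : ClauseSat α C := by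
  induction h with
  | base h => exact hα _ h
  | step _ _ _ ih1 ih2 =>
    obtain ⟨m, hm, hs⟩ := ih2
    refine ⟨m, Finset.mem_erase.2 ⟨?_, hm⟩, hs⟩
    rintro rfl
    exact (litSat_negLit _ _).1 hs ((clauseSat_singleton _ _).1 ih1)

theorem cnfSat_addUnit {φ : CNF V} {l : Lit V} {α : V → Bool} (h : CnfSat α φ)
    (hl : LitSat α l) : CnfSat α (addUnit φ l) := by
  intro C hC
  rcases Finset.mem_insert.1 hC with rfl | hC
  · exact (clauseSat_singleton _ _).2 hl
  · exact h C hC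

/-- The result of assigning the literal `l` the value true in `φ`. -/
def assignLit (φ : CNF V) (l : Lit V) : CNF V :=
  (φ.filter fun C => l ∉ C).image fun C => C.erase (negLit l)

theorem mem_assignLit {φ : CNF V} {l : Lit V} {D : Clause V} :
    D ∈ assignLit φ l ↔ ∃ C ∈ φ, l ∉ C ∧ C.erase (negLit l) = D := by
  simp [assignLit, and_assoc]

theorem IsCNF.assignLit {φ : CNF V} (h : IsCNF φ) (l : Lit V) : IsCNF (assignLit φ l) := by
  intro D hD m hm hm'
  obtain ⟨C, hC, -, rfl⟩ := mem_assignLit.1 hD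
  exact h C hC m (Finset.mem_of_mem_erase hm) (Finset.mem_of_mem_erase hm')

theorem Is2CNF.assignLit {φ : CNF V} (h : Is2CNF φ) (l : Lit V) : Is2CNF (assignLit φ l) := by
  intro D hD
  obtain ⟨C, hC, -, rfl⟩ := mem_assignLit.1 hD
  exact (Finset.card_le_card (Finset.erase_subset _ _)).trans (h C hC)

theorem card_assignLit_lt {φ : CNF V} {l : Lit V} {C : Clause V} (hC : C ∈ φ) (hl : l ∈ C) :
    (assignLit φ l).card < φ.card :=
  Finset.card_image_le.trans_lt
    (Finset.card_lt_card (Finset.filter_ssubset.2 ⟨C, hC, not_not.2 hl⟩))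

theorem CnfSat.assignLit {φ : CNF V} {l : Lit V} {α : V → Bool} (h : CnfSat α φ)
    (hl : LitSat α l) : CnfSat α (assignLit φ l) := by
  intro D hD
  obtain ⟨C, hC, -, rfl⟩ := mem_assignLit.1 hD
  obtain ⟨m, hm, hs⟩ := h C hC
  refine ⟨m, Finset.mem_erase.2 ⟨?_, hm⟩, hs⟩
  rintro rfl
  exact (litSat_negLit _ _).1 hs hl

theorem litSat_update_of_ne {l m : Lit V} {α : V → Bool} (h : LitSat α m) (hm : m ≠ negLit l) :
    LitSat (Function.update α l.1 l.2) m := by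
  rcases l with ⟨v, b⟩
  rcases m with ⟨w, c⟩
  by_cases hvw : w = v
  · subst hvw
    simp only [negLit, ne_eq, Prod.mk.injEq, true_and] at hm
    simp only [LitSat, Function.update_self]
    cases b <;> cases c <;> simp_all
  · simpa [LitSat, Function.update_of_ne hvw] using h

theorem CnfSat.update_of_assignLit {φ : CNF V} {l : Lit V} {α : V → Bool}
    (h : CnfSat α (_root_.assignLit φ l)) : CnfSat (Function.update α l.1 l.2) φ := by
  intro C hC
  by_cases hl : l ∈ C
  · exact ⟨l, hl, by simp [LitSat]⟩
  · obtain ⟨m, hm, hs⟩ := h _ (mem_assignLit.2 ⟨C, hC, hl, rfl⟩)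
    exact ⟨m, Finset.mem_of_mem_erase hm, litSat_update_of_ne hs (Finset.ne_of_mem_erase hm)⟩

/-- A literal that is an implicate of a satisfiable formula occurs in it. -/
theorem Implicate.exists_mem {φ : CNF V} {l : Lit V} (h : Implicate φ {l})
    {α : V → Bool} (hα : CnfSat α φ) : ∃ C ∈ φ, l ∈ C := by
  by_contra! hno
  have hsat : CnfSat (Function.update α (negLit l).1 (negLit l).2) φ := by
    intro C hC
    obtain ⟨m, hm, hs⟩ := hα C hC
    refine ⟨m, hm, litSat_update_of_ne hs ?_⟩
    rintro rfl
    exact hno C hC (by rwa [negLit_negLit] at hm)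
  have hl := (clauseSat_singleton _ _).1 (h _ hsat)
  have hn : LitSat (Function.update α (negLit l).1 (negLit l).2) (negLit l) := by simp [LitSat]
  exact (litSat_negLit _ _).1 hn hl

/-- The edge relation of the implication graph of a 2-CNF formula. -/
def ImplicationEdge (φ : CNF V) (l m : Lit V) : Prop := {negLit l, m} ∈ φ

/-- Reachability in the implication graph of a 2-CNF formula. -/
abbrev ImplicationPath (φ : CNF V) : Lit V → Lit V → Prop :=
  Relation.ReflTransGen (ImplicationEdge φ)

theorem ImplicationEdge.contrapose {φ : CNF V} {l m : Lit V} (h : ImplicationEdge φ l m) :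
    ImplicationEdge φ (negLit m) (negLit l) := by
  rwa [ImplicationEdge, negLit_negLit, Finset.pair_comm]

theorem ImplicationPath.contrapose {φ : CNF V} {l m : Lit V} (h : ImplicationPath φ l m) :
    ImplicationPath φ (negLit m) (negLit l) := by
  induction h with
  | refl => exact .refl
  | tail _ h ih => exact .head h.contrapose ih

theorem ImplicationPath.litSat {φ : CNF V} {l m : Lit V} (h : ImplicationPath φ l m)
    {α : V → Bool} (hα : CnfSat α φ) (hl : LitSat α l) : LitSat α m := by
  induction h with
  | refl => exact hl
  | tail _ h ih =>
    obtain ⟨k, hk, hs⟩ := hα _ h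
    rcases Finset.mem_insert.1 hk with rfl | hk
    · exact absurd ih ((litSat_negLit _ _).1 hs)
    · rwa [Finset.mem_singleton.1 hk] at hs

theorem ImplicationPath.unitDerives {φ : CNF V} {l m : Lit V} (h : ImplicationPath φ l m) :
    UnitDerives (addUnit φ l) {m} := by
  induction h with
  | refl => exact .base (Finset.mem_insert_self _ _)
  | @tail b c _ h ih =>
    have hC : UnitDerives (addUnit φ l) {negLit b, c} := .base (Finset.mem_insert_of_mem h)
    by_cases hbc : negLit b = c
    · simpa [hbc] using hC
    · have := UnitDerives.step ih hC (by simp)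
      rwa [Finset.erase_insert (by simpa using hbc)] at this

theorem ImplicationPath.implicate_negLit {φ : CNF V} {l : Lit V}
    (h : ImplicationPath φ l (negLit l)) : Implicate φ {negLit l} := by
  intro α hα
  rw [clauseSat_singleton, litSat_negLit]
  exact fun hl => (litSat_negLit _ _).1 (h.litSat hα hl) hl

/-- A consistent set of literals closed under implication edges extends to a model. -/
theorem exists_cnfSat_of_closed {φ : CNF V} {α : V → Bool} (hα : CnfSat α φ)
    (hcard : ∀ C ∈ φ, C.card = 2) (R : Lit V → Prop) (hcons : ∀ l, R l → ¬ R (negLit l))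
    (hclosed : ∀ l m, R l → ImplicationEdge φ l m → R m) :
    ∃ β : V → Bool, CnfSat β φ ∧ ∀ l, R l → LitSat β l := by
  classical
  let β : V → Bool := fun v => if R (v, true) then true else if R (v, false) then false else α v
  have hβ : ∀ l, R l → LitSat β l := by
    rintro ⟨v, b⟩ h
    cases b
    · have : ¬ R (v, true) := hcons _ h
      simp [LitSat, β, this, h]
    · simp [LitSat, β, h]
  have hβ' : ∀ l, LitSat α l → ¬ R (negLit l) → LitSat β l := by
    rintro ⟨v, b⟩ h hn
    cases b <;> simp_all [LitSat, negLit, β]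
  refine ⟨β, fun C hC => ?_, hβ⟩
  obtain ⟨k, hk, hs⟩ := hα C hC
  by_cases hR : R (negLit k)
  · obtain ⟨m, hm⟩ : ∃ m, C = {k, m} := by
      obtain ⟨a, b, -, rfl⟩ := Finset.card_eq_two.1 (hcard C hC)
      rcases Finset.mem_insert.1 hk with rfl | hk
      · exact ⟨b, rfl⟩
      · rw [Finset.mem_singleton.1 hk]
        exact ⟨a, Finset.pair_comm _ _⟩
    refine ⟨m, by simp [hm], hβ m (hclosed _ _ hR ?_)⟩
    rwa [ImplicationEdge, negLit_negLit, ← hm]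
  · exact ⟨k, hk, hβ' k hs hR⟩

/-- If no model of a satisfiable 2-CNF formula without unit implicates satisfies both `a` and `b`,
then the implication graph has a path from `a` to the negation of `b`. -/
theorem implicationPath_of_incompatible {φ : CNF V} {α : V → Bool} (hα : CnfSat α φ)
    (hcard : ∀ C ∈ φ, C.card = 2) (hunit : ∀ l, ¬ Implicate φ {l}) {a b : Lit V}
    (hab : ∀ β : V → Bool, CnfSat β φ → LitSat β a → ¬ LitSat β b) :
    ImplicationPath φ a (negLit b) := by
  by_contra hpath
  suffices ∃ β : V → Bool, CnfSat β φ ∧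
      ∀ l, ImplicationPath φ a l ∨ ImplicationPath φ b l → LitSat β l by
    obtain ⟨β, hβ, hR⟩ := this
    exact hab β hβ (hR a (.inl .refl)) (hR b (.inr .refl))
  refine exists_cnfSat_of_closed hα hcard _ ?_ ?_
  · have key : ∀ {c d l}, ImplicationPath φ c l → ImplicationPath φ d (negLit l) →
        ImplicationPath φ c (negLit d) := fun {c d l} hc hd => by
      have := hd.contrapose
      rw [negLit_negLit] at this
      exact hc.trans this
    rintro l (h | h) (h' | h')
    · exact hunit _ (key h h').implicate_negLit
    · exact hpath (key h h')
    · have := (key h h').contrapose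
      rw [negLit_negLit] at this
      exact hpath this
    · exact hunit _ (key h h').implicate_negLit
  · rintro l m (h | h) he
    · exact .inl (h.tail he)
    · exact .inr (h.tail he)

theorem cnfSat_majority {φ : CNF V} (h2 : Is2CNF φ) {α β γ : V → Bool} (hα : CnfSat α φ)
    (hβ : CnfSat β φ) (hγ : CnfSat γ φ) :
    CnfSat (fun v => (α v && β v) || (α v && γ v) || (β v && γ v)) φ := by
  intro C hC
  obtain ⟨a, ha, hsa⟩ := hα C hC
  obtain ⟨b, hb, hsb⟩ := hβ C hC
  obtain ⟨c, hc, hsc⟩ := hγ C hC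
  have hcoin : a = b ∨ a = c ∨ b = c := by
    by_contra! hne
    have hsub : ({a, b, c} : Clause V) ⊆ C := by
      simp [Finset.insert_subset_iff, ha, hb, hc]
    have h3 : ({a, b, c} : Clause V).card = 3 := Finset.card_eq_three.2
      ⟨a, b, c, hne.1, hne.2.1, hne.2.2, rfl⟩
    have := Finset.card_le_card hsub
    have := h2 C hC
    omega
  rcases hcoin with rfl | rfl | rfl
  · refine ⟨a, ha, ?_⟩
    simp only [LitSat] at hsa hsb ⊢
    rw [hsa, hsb]
    cases a.2 <;> simp
  · refine ⟨a, ha, ?_⟩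
    simp only [LitSat] at hsa hsc ⊢
    rw [hsa, hsc]
    cases a.2 <;> simp
  · refine ⟨b, hb, ?_⟩
    simp only [LitSat] at hsb hsc ⊢
    rw [hsb, hsc]
    cases b.2 <;> simp

end CnfSemantics

section AtMostOne

theorem amo_iff {n : ℕ} {α : Fin n → Bool} :
    AMO n α ↔ ∀ i j, α i = true → α j = true → i = j := by
  simp only [AMO, Finset.card_le_one, Finset.mem_filter, Finset.mem_univ, true_and]
  exact ⟨fun h i j hi hj => h i hi j hj, fun h i hi j hj => h i j hi hj⟩

variable {n ℓ : ℕ} {φ : CNF (Var n ℓ)}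

theorem Encodes.amo_of_cnfSat {f : (Fin n → Bool) → Prop} (h : Encodes φ f)
    {α : Var n ℓ → Bool} (hα : CnfSat α φ) : f (α ∘ Sum.inl) :=
  (h.2 _).2 ⟨α ∘ Sum.inr, by rwa [Sum.elim_comp_inl_inr]⟩

theorem Encodes.exists_cnfSat_inl (h : Encodes φ (AMO n)) (i : Fin n) (b : Bool) :
    ∃ α : Var n ℓ → Bool, CnfSat α φ ∧ α (Sum.inl i) = b := by
  obtain ⟨β, hβ⟩ := (h.2 (fun j => decide (j = i) && b)).1 (amo_iff.2 (by simp; grind))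
  exact ⟨_, hβ, by simp⟩

/-- A minimum 2-CNF encoding of `AMO n` has no unit implicates. -/
theorem not_implicate_singleton_of_minimum (henc : Encodes φ (AMO n)) (h2 : Is2CNF φ)
    (hmin : ∀ φ' : CNF (Var n ℓ), Encodes φ' (AMO n) → Is2CNF φ' → φ.card ≤ φ'.card)
    {α : Var n ℓ → Bool} (hα : CnfSat α φ) (l : Lit (Var n ℓ)) : ¬ Implicate φ {l} := by
  intro himp
  have hl : ∀ β, CnfSat β φ → LitSat β l := fun β hβ => (clauseSat_singleton _ _).1 (himp β hβ)
  obtain ⟨C, hC, hlC⟩ := himp.exists_mem hα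
  rcases l with ⟨i | y, b⟩
  · obtain ⟨β, hβ, hb⟩ := henc.exists_cnfSat_inl i (!b)
    have := hl β hβ
    simp [LitSat, hb] at this
  · refine (card_assignLit_lt hC hlC).not_ge
      (hmin _ ⟨henc.1.assignLit _, fun γ => ?_⟩ (h2.assignLit _))
    rw [henc.2 γ]
    constructor
    · rintro ⟨β, hβ⟩
      exact ⟨β, hβ.assignLit (hl _ hβ)⟩
    · rintro ⟨β, hβ⟩
      refine ⟨Function.update β y b, ?_⟩
      have := hβ.update_of_assignLit
      rwa [Sum.update_elim_inr] at this

theorem IsPEncoding.eq_of_cnfSat (h : IsPEncoding φ) {α : Var n ℓ → Bool} (hα : CnfSat α φ)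
    {i j : Fin n} (hi : α (Sum.inl i) = true) (hj : α (Sum.inl j) = true) : i = j := by
  by_contra hij
  have := (clauseSat_singleton _ _).1 ((h.2.2 i j hij).clauseSat (cnfSat_addUnit hα hi))
  simp [LitSat, inLit, hj] at this

/-- A 2-CNF p-encoding with at least three input variables encodes `AMO n`. -/
theorem IsPEncoding.encodes_amo (hn : 3 ≤ n) (h : IsPEncoding φ) (h2 : Is2CNF φ) :
    Encodes φ (AMO n) := by
  refine ⟨h.1, fun α => ⟨fun hα => ?_, ?_⟩⟩
  · rw [amo_iff] at hα
    suffices ∃ γ : Var n ℓ → Bool, CnfSat γ φ ∧ γ ∘ Sum.inl = α by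
      obtain ⟨γ, hγ, rfl⟩ := this
      exact ⟨γ ∘ Sum.inr, by rwa [Sum.elim_comp_inl_inr]⟩
    choose γ hγ hγi using h.2.1
    have hval : ∀ i j, γ i (Sum.inl j) = decide (i = j) := fun i j => by
      by_cases hij : i = j
      · simp [← hij, hγi]
      · simpa [hij] using fun hj => hij (h.eq_of_cnfSat (hγ i) (hγi i) hj)
    by_cases hex : ∃ i, α i = true
    · obtain ⟨i, hi⟩ := hex
      refine ⟨γ i, hγ i, funext fun j => ?_⟩
      by_cases hij : i = j
      · simp [hval, ← hij, hi]
      · have : α j = false := by simpa using fun hj => hij (hα i j hi hj)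
        simp [hval, hij, this]
    · refine ⟨_, cnfSat_majority h2 (hγ ⟨0, by omega⟩) (hγ ⟨1, by omega⟩) (hγ ⟨2, by omega⟩),
        funext fun j => ?_⟩
      have : α j = false := by simpa using fun hj => hex ⟨j, hj⟩
      rw [this]
      simp only [Function.comp_apply, hval, Fin.ext_iff]
      grind
  · rintro ⟨β, hβ⟩
    exact amo_iff.2 fun i j hi hj => h.eq_of_cnfSat hβ hi hj

end AtMostOne

/-- Let n ≥ 3 and let φ be a 2-CNF encoding of AMO_n of minimum size.
Then φ has no unit implicates, φ is a prime p-encoding, and |φ| = S₂(n). -/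
theorem min_two_cnf_encoding_amo (n : ℕ) (hn : 3 ≤ n) (ℓ : ℕ) (φ : CNF (Var n ℓ))
    (henc : Encodes φ (AMO n)) (h2 : Is2CNF φ)
    (hmin : ∀ ℓ' : ℕ, ∀ φ' : CNF (Var n ℓ'), Encodes φ' (AMO n) → Is2CNF φ' →
      φ.card ≤ φ'.card) :
    (∀ l : Lit (Var n ℓ), ¬ Implicate φ {l}) ∧ IsPrime φ ∧ IsPEncoding φ ∧
      φ.card = S2 n := by
  obtain ⟨α, hα, -⟩ := henc.exists_cnfSat_inl ⟨0, by omega⟩ true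
  have hunit : ∀ l, ¬ Implicate φ {l} :=
    not_implicate_singleton_of_minimum henc h2 (fun φ' => hmin ℓ φ') hα
  have hempty : ¬ Implicate φ ∅ := fun h => by simpa [ClauseSat] using h α hα
  have himp : ∀ C ∈ φ, Implicate φ C := fun C hC β hβ => hβ C hC
  have hsmall : ∀ C : Clause (Var n ℓ), C.card ≤ 1 → ¬ Implicate φ C := by
    intro C hC
    rcases C.eq_empty_or_nonempty with rfl | hne
    · exact hempty
    · obtain ⟨l, rfl⟩ := Finset.card_eq_one.1 (le_antisymm hC hne.card_pos)
      exact hunit l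
  have hcard : ∀ C ∈ φ, C.card = 2 := fun C hC => by
    have := h2 C hC
    have := mt (hsmall C) (not_not.2 (himp C hC))
    omega
  have hpenc : IsPEncoding φ := by
    refine ⟨henc.1, fun i => henc.exists_cnfSat_inl i true, fun i j hij => ?_⟩
    refine (implicationPath_of_incompatible (b := inLit j true) hα hcard hunit
      fun β hβ hi hj => hij ?_).unitDerives
    exact amo_iff.1 (henc.amo_of_cnfSat hβ) i j hi hj
  refine ⟨hunit, fun C hC => ⟨himp C hC, fun C' hC' => hsmall C' ?_⟩, hpenc, ?_⟩
  · have := Finset.card_lt_card hC'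
    have := hcard C hC
    omega
  · have hmem : φ.card ∈ penc2Sizes n := ⟨ℓ, φ, hpenc, h2, rfl⟩
    refine le_antisymm ?_ (Nat.sInf_le hmem)
    obtain ⟨ℓ', ψ, hψ, hψ2, hψc⟩ := Nat.sInf_mem ⟨_, hmem⟩
    exact (hmin ℓ' ψ (hψ.encodes_amo hn hψ2) hψ2).trans_eq hψc
end

section
/- Let φ(x,y) be an encoding of a boolean function f(x) of minimum size that, moreover, has the minimum number of auxiliary variables among the minimum size encodings of f. Then every auxiliary variable y ∈ y occurs (as a positive or negative literal) in at least 5 clauses of φ. -/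
lemma clauseSat_of_not_isClause {W : Type} [DecidableEq W] {C : Clause W} (hC : ¬IsClause C) (δ : W → Bool) :
    ClauseSat δ C := by
  simp only [IsClause, not_forall, not_not] at hC
  obtain ⟨l, hl, hl'⟩ := hC
  by_cases h : δ l.1 = l.2
  · exact ⟨l, hl, h⟩
  · exact ⟨negLit l, hl', Bool.eq_not_of_ne h⟩

lemma clauseSat_union {W : Type} [DecidableEq W] {C D : Clause W} {δ : W → Bool} :
    ClauseSat δ (C ∪ D) ↔ ClauseSat δ C ∨ ClauseSat δ D := by
  simp only [ClauseSat, Finset.mem_union, or_and_right, exists_or]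

/-- The pullback of a clause along a map of variables; literals on variables outside the range
of the map are dropped. -/
def pullClause {V W : Type} [DecidableEq V] [Fintype W] (e : W → V) (C : Clause V) : Clause W :=
  Finset.univ.filter fun l => (e l.1, l.2) ∈ C

/-- Davis–Putnam elimination of the variable `y`: the clauses containing `y` are replaced by their
non-tautological resolvents on `y`, and the result is pulled back along `e`. -/
def eliminateVar {V W : Type} [DecidableEq V] [Fintype W] [DecidableEq W] (e : W → V) (y : V)
    (φ : CNF V) : CNF W :=
  (φ.filter fun C => ¬((y, true) ∈ C ∨ (y, false) ∈ C)).image (pullClause e) ∪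
    (Finset.image₂ (fun C D => pullClause e C ∪ pullClause e D)
      (φ.filter fun C => (y, true) ∈ C) (φ.filter fun C => (y, false) ∈ C)).filter
      fun C => IsClause C

section

variable {V W : Type} [DecidableEq V] [Fintype W] {e : W → V} {y : V}

lemma mem_pullClause {C : Clause V} {l : Lit W} : l ∈ pullClause e C ↔ (e l.1, l.2) ∈ C := by
  simp [pullClause]

lemma IsClause.pullClause [DecidableEq W] {C : Clause V} (hC : IsClause C) :
    IsClause (pullClause e C) := by
  intro l hl h
  rw [mem_pullClause] at hl h
  exact hC _ hl h

lemma clauseSat_iff_pullClause (hsurj : ∀ v, v ≠ y → ∃ w, e w = v) (hy : ∀ w, e w ≠ y)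
    (γ : V → Bool) (C : Clause V) :
    ClauseSat γ C ↔ ClauseSat (γ ∘ e) (pullClause e C) ∨ (y, γ y) ∈ C := by
  constructor
  · rintro ⟨⟨v, b⟩, hl, hs⟩
    simp only [LitSat] at hs
    by_cases hv : v = y
    · subst hv hs
      exact Or.inr hl
    · obtain ⟨w, rfl⟩ := hsurj v hv
      exact Or.inl ⟨(w, b), mem_pullClause.2 hl, hs⟩
  · rintro (⟨l, hl, hs⟩ | h)
    · exact ⟨_, mem_pullClause.1 hl, hs⟩
    · exact ⟨_, h, rfl⟩

lemma isCNF_eliminateVar [DecidableEq W] {φ : CNF V} (hφ : IsCNF φ) :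
    IsCNF (eliminateVar e y φ) := by
  intro C hC
  rcases Finset.mem_union.1 hC with h | h
  · obtain ⟨D, hD, rfl⟩ := Finset.mem_image.1 h
    exact (hφ D (Finset.mem_filter.1 hD).1).pullClause
  · exact (Finset.mem_filter.1 h).2

lemma cnfSat_eliminateVar [DecidableEq W] {φ : CNF V} (hφ : IsCNF φ)
    (hsurj : ∀ v, v ≠ y → ∃ w, e w = v) (hy : ∀ w, e w ≠ y) {γ : V → Bool} (hγ : CnfSat γ φ) :
    CnfSat (γ ∘ e) (eliminateVar e y φ) := by
  have key := clauseSat_iff_pullClause hsurj hy γ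
  intro C hC
  rcases Finset.mem_union.1 hC with h | h
  · obtain ⟨D, hD, rfl⟩ := Finset.mem_image.1 h
    obtain ⟨hD, hyD⟩ := Finset.mem_filter.1 hD
    refine ((key D).1 (hγ D hD)).resolve_right fun h => hyD ?_
    cases hb : γ y <;> simp_all
  · obtain ⟨A, hA, B, hB, rfl⟩ := Finset.mem_image₂.1 (Finset.mem_filter.1 h).1
    obtain ⟨hA, hyA⟩ := Finset.mem_filter.1 hA
    obtain ⟨hB, hyB⟩ := Finset.mem_filter.1 hB
    rw [clauseSat_union]
    cases hb : γ y
    · refine Or.inl (((key A).1 (hγ A hA)).resolve_right fun h => ?_)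
      rw [hb] at h
      exact hφ A hA _ hyA h
    · refine Or.inr (((key B).1 (hγ B hB)).resolve_right fun h => ?_)
      rw [hb] at h
      exact hφ B hB _ hyB h

lemma exists_cnfSat_of_eliminateVar [DecidableEq W] {φ : CNF V}
    (hsurj : ∀ v, v ≠ y → ∃ w, e w = v) (hy : ∀ w, e w ≠ y) {δ : W → Bool}
    (hδ : CnfSat δ (eliminateVar e y φ)) :
    ∃ b, ∀ γ : V → Bool, γ ∘ e = δ → γ y = b → CnfSat γ φ := by
  have hres : ∀ A ∈ φ, (y, true) ∈ A → ∀ B ∈ φ, (y, false) ∈ B →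
      ClauseSat δ (pullClause e A) ∨ ClauseSat δ (pullClause e B) := by
    intro A hA hyA B hB hyB
    rw [← clauseSat_union]
    by_cases h : IsClause (pullClause e A ∪ pullClause e B)
    · exact hδ _ (Finset.mem_union_right _ (Finset.mem_filter.2 ⟨Finset.mem_image₂_of_mem
        (Finset.mem_filter.2 ⟨hA, hyA⟩) (Finset.mem_filter.2 ⟨hB, hyB⟩), h⟩))
    · exact clauseSat_of_not_isClause h δ
  have hnon : ∀ C ∈ φ, ¬((y, true) ∈ C ∨ (y, false) ∈ C) → ClauseSat δ (pullClause e C) :=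
    fun C hC h => hδ _ (Finset.mem_union_left _
      (Finset.mem_image_of_mem _ (Finset.mem_filter.2 ⟨hC, h⟩)))
  by_cases hpos : ∀ A ∈ φ, (y, true) ∈ A → ClauseSat δ (pullClause e A)
  · refine ⟨false, fun γ hγ hb C hC => (clauseSat_iff_pullClause hsurj hy γ C).2 ?_⟩
    rw [hγ, hb]
    by_cases hF : (y, false) ∈ C
    · exact Or.inr hF
    · by_cases hT : (y, true) ∈ C
      · exact Or.inl (hpos C hC hT)
      · exact Or.inl (hnon C hC (by tauto))
  · push Not at hpos
    obtain ⟨A, hA, hyA, hnA⟩ := hpos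
    refine ⟨true, fun γ hγ hb C hC => (clauseSat_iff_pullClause hsurj hy γ C).2 ?_⟩
    rw [hγ, hb]
    by_cases hT : (y, true) ∈ C
    · exact Or.inr hT
    · by_cases hF : (y, false) ∈ C
      · exact Or.inl ((hres A hA hyA C hC hF).resolve_left hnA)
      · exact Or.inl (hnon C hC (by tauto))

lemma card_eliminateVar_le [DecidableEq W] {φ : CNF V} (hφ : IsCNF φ)
    (h : (φ.filter fun C => (y, true) ∈ C ∨ (y, false) ∈ C).card ≤ 4) :
    (eliminateVar e y φ).card ≤ φ.card := by
  have hdisj : Disjoint (φ.filter fun C => (y, true) ∈ C) (φ.filter fun C => (y, false) ∈ C) :=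
    Finset.disjoint_filter.2 fun C hC hT => hφ C hC _ hT
  rw [Finset.filter_or, Finset.card_union_of_disjoint hdisj] at h
  have hsplit := Finset.card_filter_add_card_filter_not (s := φ)
    (fun C => (y, true) ∈ C ∨ (y, false) ∈ C)
  rw [Finset.filter_or, Finset.card_union_of_disjoint hdisj] at hsplit
  have hcard : (eliminateVar e y φ).card ≤
      (φ.filter fun C => ¬((y, true) ∈ C ∨ (y, false) ∈ C)).card +
      (φ.filter fun C => (y, true) ∈ C).card * (φ.filter fun C => (y, false) ∈ C).card :=
    (Finset.card_union_le _ _).trans (add_le_add Finset.card_image_le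
      ((Finset.card_filter_le _ _).trans (Finset.card_image₂_le _ _ _)))
  have hmul : ∀ p q : ℕ, p + q ≤ 4 → p * q ≤ p + q := by
    intro p q hpq
    have hp : p ≤ 4 := by omega
    interval_cases p <;> omega
  have := hmul _ _ h
  omega

end

lemma Encodes.eliminateVar {n m : ℕ} {f : (Fin n → Bool) → Prop} {φ : CNF (Var n (m + 1))}
    (h : Encodes φ f) (y : Fin (m + 1)) :
    Encodes (eliminateVar (Sum.map id y.succAbove : Var n m → Var n (m + 1)) (Sum.inr y) φ) f := by
  have hsurj : ∀ v : Var n (m + 1), v ≠ Sum.inr y →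
      ∃ w : Var n m, Sum.map id y.succAbove w = v := by
    rintro (i | j) hv
    · exact ⟨Sum.inl i, rfl⟩
    · obtain ⟨k, rfl⟩ := Fin.exists_succAbove_eq (x := j) (y := y) fun h => hv (h ▸ rfl)
      exact ⟨Sum.inr k, rfl⟩
  have hy : ∀ w : Var n m, Sum.map id y.succAbove w ≠ (Sum.inr y : Var n (m + 1)) := by
    rintro (i | j) <;> simp [Fin.succAbove_ne]
  refine ⟨isCNF_eliminateVar h.1, fun α => (h.2 α).trans ⟨?_, ?_⟩⟩
  · rintro ⟨β, hβ⟩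
    refine ⟨β ∘ y.succAbove, ?_⟩
    have := cnfSat_eliminateVar h.1 hsurj hy hβ
    rwa [Sum.elim_comp_map, Function.comp_id] at this
  · rintro ⟨β, hβ⟩
    obtain ⟨b, hb⟩ := exists_cnfSat_of_eliminateVar hsurj hy hβ
    refine ⟨y.insertNth b β, hb _ ?_ (by simp)⟩
    ext (i | j) <;> simp

/-- Let φ be an encoding of f of minimum size that, moreover, has the
minimum number of auxiliary variables among the minimum size encodings of f. Then
every auxiliary variable occurs in at least 5 clauses of φ. -/
theorem aux_var_occurrences (n ℓ : ℕ) (f : (Fin n → Bool) → Prop)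
    (φ : CNF (Var n ℓ)) (henc : Encodes φ f)
    (hminsize : ∀ ℓ' : ℕ, ∀ φ' : CNF (Var n ℓ'), Encodes φ' f → φ.card ≤ φ'.card)
    (hminaux : ∀ ℓ' : ℕ, ∀ φ' : CNF (Var n ℓ'), Encodes φ' f → φ'.card = φ.card →
      ℓ ≤ ℓ') :
    ∀ y : Fin ℓ, 5 ≤ (occursIn φ y).card := by
  intro y
  by_contra! hlt
  obtain _ | m := ℓ
  · exact y.elim0
  have henc' := henc.eliminateVar y
  have hle := card_eliminateVar_le (e := (Sum.map id y.succAbove : Var n m → Var n (m + 1)))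
    (y := Sum.inr y) henc.1 (Nat.le_of_lt_succ hlt)
  have := hminaux m _ henc' (hle.antisymm (hminsize m _ henc'))
  omega
end

section
/- Let φ(x,y) be a prime p-encoding with input variables x=(x_1,…,x_n) and auxiliary variables y, let C ∈ φ be a clause with ¬x_i ∈ C. Then either C = ¬x_i ∨ A for some nonempty set A of literals on auxiliary variables, or C = ¬x_i ∨ ¬x_j for some j ≠ i. -/
/-- Unit resolution is sound. -/
theorem UnitDerives.implicate {V : Type} [DecidableEq V] {φ : CNF V} {C : Clause V}
    (h : UnitDerives φ C) : Implicate φ C := by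
  intro α hα
  induction h with
  | base h => exact hα _ h
  | step _ _ _ ih1 ih2 =>
    obtain ⟨a, ha, hsa⟩ := ih1
    obtain rfl := Finset.mem_singleton.1 ha
    obtain ⟨b, hb, hsb⟩ := ih2
    refine ⟨b, Finset.mem_erase.2 ⟨?_, hb⟩, hsb⟩
    rintro rfl
    have hsa' : α a.1 = a.2 := hsa
    have hsb' : α a.1 = !a.2 := hsb
    simp [hsa'] at hsb'

/-- In a p-encoding, no satisfying assignment sets two input variables to true. -/
theorem IsPEncoding.eq_false_of_eq_true {n ℓ : ℕ} {φ : CNF (Var n ℓ)} (hpe : IsPEncoding φ)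
    {i j : Fin n} (hij : i ≠ j) {α : Var n ℓ → Bool} (hα : CnfSat α φ)
    (hi : α (Sum.inl i) = true) : α (Sum.inl j) = false := by
  have hsat : CnfSat α (addUnit φ (inLit i true)) := by
    intro C hC
    rcases Finset.mem_insert.1 hC with rfl | hC
    · exact ⟨_, Finset.mem_singleton_self _, hi⟩
    · exact hα C hC
  obtain ⟨a, ha, hsa⟩ := (hpe.2.2 i j hij).implicate α hsat
  obtain rfl := Finset.mem_singleton.1 ha
  exact hsa

/-- A prime implicate contains no proper implicate. -/
theorem PrimeImplicate.eq_of_subset {V : Type} {φ : CNF V} {C D : Clause V}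
    (hC : PrimeImplicate φ C) (hDC : D ⊆ C) (hD : Implicate φ D) : D = C :=
  hDC.eq_or_ssubset.resolve_right fun h => hC.2 D h hD

/-- Let φ be a prime p-encoding, C ∈ φ a clause with ¬x_i ∈ C. Then
either C = ¬x_i ∨ A for a nonempty set A of literals on auxiliary variables, or
C = ¬x_i ∨ ¬x_j for some j ≠ i. -/
theorem clause_with_negative_input_literal (n ℓ : ℕ) (φ : CNF (Var n ℓ))
    (hpe : IsPEncoding φ) (hprime : IsPrime φ) (i : Fin n)
    (C : Clause (Var n ℓ)) (hC : C ∈ φ) (hneg : inLit i false ∈ C) :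
    ((∀ l ∈ C, l ≠ inLit i false → ∃ y : Fin ℓ, l.1 = Sum.inr y) ∧ 2 ≤ C.card) ∨
    (∃ j : Fin n, j ≠ i ∧ C = {inLit i false, inLit j false}) := by
  by_cases hneg' : ∃ j : Fin n, j ≠ i ∧ inLit j false ∈ C
  · obtain ⟨j, hji, hj⟩ := hneg'
    refine Or.inr ⟨j, hji, ((hprime C hC).eq_of_subset ?_ ?_).symm⟩
    · simp [Finset.insert_subset_iff, hneg, hj]
    · intro α hα
      cases hi : α (Sum.inl i) with
      | false => exact ⟨inLit i false, by simp, hi⟩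
      | true => exact ⟨inLit j false, by simp, hpe.eq_false_of_eq_true hji.symm hα hi⟩
  · refine Or.inl ⟨?_, ?_⟩
    · rintro ⟨j | y, b⟩ hl hne
      · exfalso
        cases b with
        | false => exact hneg' ⟨j, fun h => hne (by rw [h]; rfl), hl⟩
        | true =>
          by_cases hji : j = i
          · subst hji
            exact hpe.1 C hC _ hneg hl
          · have himp : Implicate φ (C.erase (Sum.inl j, true)) := by
              intro α hα
              obtain ⟨l, hlC, hls⟩ := hα C hC
              by_cases h : l = (Sum.inl j, true)
              · subst h
                exact ⟨inLit i false, Finset.mem_erase.2 ⟨fun h => hne.symm (by simp [inLit] at h),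
                  hneg⟩, hpe.eq_false_of_eq_true hji hα hls⟩
              · exact ⟨l, Finset.mem_erase.2 ⟨h, hlC⟩, hls⟩
            exact (hprime C hC).2 _ (Finset.erase_ssubset hl) himp
      · exact ⟨y, rfl⟩
    · by_contra hcard
      have hone : C.card ≤ 1 := by omega
      obtain ⟨α, hα, hi⟩ := hpe.2.1 i
      obtain ⟨l, hl, hls⟩ := hα C hC
      obtain rfl := Finset.card_le_one.1 hone l hl _ hneg
      have hi' : α (Sum.inl i) = false := hls
      simp [hi] at hi'
end
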